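/- Let λ_0, …, λ_5 be pairwise distinct complex numbers. Then Σ_{0≤i<j≤5} (λ_i + λ_j)^2 · P_4(λ_i,λ_j)^2 / D_{ij} = 2. -/

import Mathlib

open Finset in
/-- Bott denominator: `D_{ij} = ∏_{k ≠ i,j} (λ_i − λ_k)(λ_j − λ_k)`. -/
noncomputable def bottD {n : ℕ} (l : Fin n → ℂ) (i j : Fin n) : ℂ :=
  ∏ k ∈ (Finset.univ \ {i, j}), (l i - l k) * (l j - l k)

/-- `P_c(x,y) = Σ_{t=0}^{c−1} x^t y^{c−1−t}`. -/
noncomputable def bottP (c : ℕ) (x y : ℂ) : ℂ :=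
  ∑ t ∈ Finset.range c, x ^ t * y ^ (c - 1 - t)

/-- Lagrange's identity for the power sums weighted by `∏_{j ≠ i} (l i - l j)⁻¹`. -/
theorem sum_pow_div_prod_sub {n : ℕ} {l : Fin n → ℂ} (hl : Function.Injective l) {k : ℕ}
    (hk : k < n) :
    ∑ i, l i ^ k / ∏ j ∈ Finset.univ.erase i, (l i - l j) = if n - 1 = k then 1 else 0 := by
  have h := Lagrange.coeff_eq_sum (s := Finset.univ) (v := l) hl.injOn
    (P := (Polynomial.X ^ k : Polynomial ℂ)) (by simpa using hk)
  simpa [Polynomial.coeff_X_pow] using h.symm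

theorem sum_sum_mul_div_prod_sub {n : ℕ} {l : Fin n → ℂ} (hl : Function.Injective l) {a b : ℕ}
    (h : a < n - 1 ∨ b < n - 1) :
    ∑ i, ∑ j, (l i ^ a / ∏ k ∈ Finset.univ.erase i, (l i - l k)) *
      (l j ^ b / ∏ k ∈ Finset.univ.erase j, (l j - l k)) = 0 := by
  rw [← Finset.sum_mul_sum]
  rcases h with h | h
  · rw [sum_pow_div_prod_sub hl (k := a) (by omega), if_neg (by omega), zero_mul]
  · rw [sum_pow_div_prod_sub hl (k := b) (by omega), if_neg (by omega), mul_zero]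

theorem prod_sub_mul_prod_sub_eq_bottD {n : ℕ} (l : Fin n → ℂ) {i j : Fin n} (hij : i ≠ j) :
    (∏ k ∈ Finset.univ.erase i, (l i - l k)) * ∏ k ∈ Finset.univ.erase j, (l j - l k) =
      -(l i - l j) ^ 2 * bottD l i j := by
  have hi : (Finset.univ.erase i).erase j = Finset.univ \ {i, j} := by ext; simp; tauto
  have hj : (Finset.univ.erase j).erase i = Finset.univ \ {i, j} := by ext; simp
  rw [← Finset.mul_prod_erase _ _ (show j ∈ Finset.univ.erase i by simp [hij.symm]),
    ← Finset.mul_prod_erase _ _ (show i ∈ Finset.univ.erase j by simp [hij]), hi, hj, bottD,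
    Finset.prod_mul_distrib]
  ring

theorem sum_sum_eq_two_mul_sum_lt {ι R : Type*} [Fintype ι] [LinearOrder ι] [CommSemiring R]
    (g : ι → ι → R) (hsymm : ∀ i j, g i j = g j i) (hdiag : ∀ i, g i i = 0) :
    ∑ i, ∑ j, g i j =
      2 * ∑ p ∈ Finset.univ.filter (fun p : ι × ι => p.1 < p.2), g p.1 p.2 := by
  have hsplit (i j : ι) :
      g i j = (if i < j then g i j else 0) + (if j < i then g j i else 0) := by
    rcases lt_trichotomy i j with h | rfl | h
    · simp [h, h.not_gt]
    · simp [hdiag]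
    · simp [h, h.not_gt, hsymm i j]
  rw [Finset.sum_filter, Fintype.sum_prod_type, two_mul]
  conv_lhs => enter [2, i, 2, j]; rw [hsplit]
  simp_rw [Finset.sum_add_distrib]
  congr 1
  exact Finset.sum_comm

/-- Bott's formula for `N_1(1,0,2,0) = 2` in ℙ⁵. -/
theorem bott_sum_16 (l : Fin 6 → ℂ) (hl : Function.Injective l) :
    ∑ p ∈ Finset.univ.filter (fun p : Fin 6 × Fin 6 => p.1 < p.2),
      (l p.1 + l p.2) ^ 2 * (bottP 4 (l p.1) (l p.2)) ^ 2 / bottD l p.1 p.2 = 2 := by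
  set w : Fin 6 → ℂ := fun i => ∏ k ∈ Finset.univ.erase i, (l i - l k)
  have hw0 (i : Fin 6) : w i ≠ 0 := Finset.prod_ne_zero_iff.2 fun k hk =>
    sub_ne_zero.2 (hl.ne (Finset.ne_of_mem_erase hk).symm)
  set g : Fin 6 → Fin 6 → ℂ := fun i j =>
    -((l i + l j) ^ 2 * (l i ^ 4 - l j ^ 4) ^ 2) / (w i * w j) with hg
  have hterm (p : Fin 6 × Fin 6) (hp : p.1 < p.2) :
      (l p.1 + l p.2) ^ 2 * (bottP 4 (l p.1) (l p.2)) ^ 2 / bottD l p.1 p.2 = g p.1 p.2 := by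
    have hD : w p.1 * w p.2 = -(l p.1 - l p.2) ^ 2 * bottD l p.1 p.2 :=
      prod_sub_mul_prod_sub_eq_bottD l hp.ne
    have hww := mul_ne_zero (hw0 p.1) (hw0 p.2)
    have hD0 : bottD l p.1 p.2 ≠ 0 := fun h => hww (by rw [hD, h, mul_zero])
    rw [hg, div_eq_div_iff hD0 hww, hD]
    simp only [bottP, Finset.sum_range_succ, Finset.sum_range_zero]
    ring
  have hexpand (i j : Fin 6) : g i j =
      -(l i ^ 10 / w i * (l j ^ 0 / w j)) - 2 * (l i ^ 9 / w i * (l j ^ 1 / w j))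
      - l i ^ 8 / w i * (l j ^ 2 / w j) + 2 * (l i ^ 6 / w i * (l j ^ 4 / w j))
      + 4 * (l i ^ 5 / w i * (l j ^ 5 / w j)) + 2 * (l i ^ 4 / w i * (l j ^ 6 / w j))
      - l i ^ 2 / w i * (l j ^ 8 / w j) - 2 * (l i ^ 1 / w i * (l j ^ 9 / w j))
      - l i ^ 0 / w i * (l j ^ 10 / w j) := by
    simp only [hg]
    field_simp [hw0 i, hw0 j]
    ring
  have hzero (a b : ℕ) (h : a < 5 ∨ b < 5) :
      ∑ i, ∑ j, l i ^ a / w i * (l j ^ b / w j) = 0 := sum_sum_mul_div_prod_sub hl h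
  have htop : ∑ i, ∑ j, l i ^ 5 / w i * (l j ^ 5 / w j) = 1 := by
    have h : ∑ i, l i ^ 5 / w i = 1 := sum_pow_div_prod_sub hl (k := 5) (by norm_num)
    rw [← Finset.sum_mul_sum, h, mul_one]
  have hsum : ∑ i, ∑ j, g i j = 4 := by
    simp only [hexpand, Finset.sum_add_distrib, Finset.sum_sub_distrib, Finset.sum_neg_distrib,
      ← Finset.mul_sum _ _ (2 : ℂ), ← Finset.mul_sum _ _ (4 : ℂ)]
    rw [hzero 10 0 (by norm_num), hzero 9 1 (by norm_num), hzero 8 2 (by norm_num),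
      hzero 6 4 (by norm_num), htop, hzero 4 6 (by norm_num), hzero 2 8 (by norm_num),
      hzero 1 9 (by norm_num), hzero 0 10 (by norm_num)]
    norm_num
  rw [Finset.sum_congr rfl fun p hp => hterm p (Finset.mem_filter.1 hp).2]
  have hdouble := sum_sum_eq_two_mul_sum_lt g (fun i j => by simp only [hg]; ring)
    (fun i => by simp [hg])
  rw [hsum] at hdouble
  linear_combination -hdouble / 2
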